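/- For a multi-valued regulatory graph G=(V,E,ρ), a parametrization K ∈ K_G and an edge (u,n,v) ∈ E, the following two non-observability conditions are equivalent: (i) for every s∈S with s_u∈[n_−,n_+) there exists k∈[0,ρ(v)] such that for all j∈[n_−,n_+): δ(F^K_v)(s_{u←j}) = Sgn(k − (s_{u←j})_v); (ii) for every s∈S with s_u∈[n_−,n_+) and for all j∈[n_−,n_+): δ(F^K_v)(s_{u←j}) = Sgn((F^K_v)^mon(s) − (s_{u←j})_v). -/

import Mathlib

/-!
Formalization of multi-valued regulatory graphs (Thomas networks),
their parametrizations, asynchronous transition systems,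
canonization, completion, normalization and minimization.
-/

namespace MVReg

open Classical

/-- A multi-valued regulatory graph over components `V` with maximal
activity levels `ρ`: a finite set of regulations `(u, n, v)` with
threshold `0 < n ≤ ρ u`. -/
structure RegGraph (V : Type*) (ρ : V → ℕ) where
  E : Finset (V × ℕ × V)
  valid : ∀ e ∈ E, 1 ≤ e.2.1 ∧ e.2.1 ≤ ρ e.1

/-- A (total) parametrization candidate: a value for each component and
each potential regulatory context (a context assigns to each regulator
an interval, represented by its pair of endpoints `[j, k)`). -/
abbrev Param (V : Type*) := V → (V → ℕ × ℕ) → ℕ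

variable {V : Type*} [DecidableEq V] [Fintype V] {ρ : V → ℕ}

/-- The extended threshold set `Θ(u,v) = θ(u,v) ∪ {0, ρ u + 1}`. -/
def Theta (G : RegGraph V ρ) (u v : V) : Set ℕ :=
  {m | (u, m, v) ∈ G.E} ∪ {0, ρ u + 1}

/-- Activity intervals `I_v^u`: pairs `(j,k)` (representing `[j,k)`) of
consecutive members of `Θ(u,v)`. -/
def ActInterval (G : RegGraph V ρ) (u v : V) : Set (ℕ × ℕ) :=
  {p | p.1 ∈ Theta G u v ∧ p.2 ∈ Theta G u v ∧ p.1 < p.2 ∧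
    ∀ l ∈ Theta G u v, ¬ (p.1 < l ∧ l < p.2)}

/-- The regulatory contexts `Ω_v` of a component `v`. -/
def Context (G : RegGraph V ρ) (v : V) : Set (V → ℕ × ℕ) :=
  {ω | ∀ u, ω u ∈ ActInterval G u v}

/-- `K ∈ 𝒦_G` : on every regulatory context of `v` the value lies in `[0, ρ v]`. -/
def IsParam (G : RegGraph V ρ) (K : Param V) : Prop :=
  ∀ v : V, ∀ ω ∈ Context G v, K v ω ≤ ρ v

/-- The state space `S = ∏_v [0, ρ v]`. -/
def States (ρ : V → ℕ) : Set (V → ℕ) := {s | ∀ v, s v ≤ ρ v}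

/-- `s ∈ ω` : the state `s` lies in the context `ω`. -/
def memCtx (ω : V → ℕ × ℕ) (s : V → ℕ) : Prop :=
  ∀ u, (ω u).1 ≤ s u ∧ s u < (ω u).2

/-- The (unique) regulatory context of `v` containing the state `s`. -/
noncomputable def ctxOf (G : RegGraph V ρ) (v : V) (s : V → ℕ) : V → ℕ × ℕ :=
  fun u => (sSup {m | m ∈ Theta G u v ∧ m ≤ s u}, sInf {m | m ∈ Theta G u v ∧ s u < m})

/-- The asynchronous update function `F^K_v`. -/
noncomputable def F (G : RegGraph V ρ) (K : Param V) (v : V) (s : V → ℕ) : ℕ :=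
  if s v < K v (ctxOf G v s) then s v + 1
  else if s v = K v (ctxOf G v s) then s v
  else s v - 1

/-- The derivative `δ(F^K_v)(s) = F^K_v(s) − s_v` (as an integer). -/
noncomputable def delta (G : RegGraph V ρ) (K : Param V) (v : V) (s : V → ℕ) : ℤ :=
  (F G K v s : ℤ) - (s v : ℤ)

/-- The asynchronous transition system `T_G(K)`, as the set of transitions. -/
noncomputable def TS (G : RegGraph V ρ) (K : Param V) : Set ((V → ℕ) × (V → ℕ)) :=
  {p | p.1 ∈ States ρ ∧ p.2 ∈ States ρ ∧ p.1 ≠ p.2 ∧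
    ∃ v : V, p.2 = Function.update p.1 v (F G K v p.1)}

/-- The synchronous transition system of `(G, K)`. -/
noncomputable def SyncTS (G : RegGraph V ρ) (K : Param V) : Set ((V → ℕ) × (V → ℕ)) :=
  {p | p.1 ∈ States ρ ∧ p.2 ∈ States ρ ∧ ∀ v : V, p.2 v = F G K v p.1}

/-- A parametrization is canonical iff `j − 1 ≤ K_v(ω) ≤ k` for every context with
`ω_v = [j,k)`. -/
def Canonical (G : RegGraph V ρ) (K : Param V) : Prop :=
  ∀ v : V, ∀ ω ∈ Context G v, (ω v).1 - 1 ≤ K v ω ∧ K v ω ≤ (ω v).2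

/-- The canonization of a parametrization. -/
noncomputable def CanP (K : Param V) : Param V := fun v ω =>
  if K v ω + 1 < (ω v).1 then (ω v).1 - 1
  else if (ω v).2 < K v ω then (ω v).2
  else K v ω

/-- A regulatory graph is complete iff it contains every possible edge. -/
def Complete (G : RegGraph V ρ) : Prop :=
  ∀ u v : V, ∀ n : ℕ, 1 ≤ n → n ≤ ρ u → (u, n, v) ∈ G.E

/-- The finite set of all possible edges for activity levels `ρ`. -/
def allEdges (ρ : V → ℕ) : Finset (V × ℕ × V) :=
  Finset.filter (fun e => 1 ≤ e.2.1 ∧ e.2.1 ≤ ρ e.1)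
    (Finset.univ ×ˢ (Finset.Icc 1 (Finset.univ.sup ρ)) ×ˢ Finset.univ)

/-- `n_−`: the largest element of `Θ(u,v)` strictly below `n`. -/
noncomputable def nminus (G : RegGraph V ρ) (u v : V) (n : ℕ) : ℕ :=
  sSup {m | m ∈ Theta G u v ∧ m < n}

/-- `n_+`: the smallest element of `Θ(u,v)` strictly above `n`. -/
noncomputable def nplus (G : RegGraph V ρ) (u v : V) (n : ℕ) : ℕ :=
  sInf {m | m ∈ Theta G u v ∧ n < m}

/-- The parametrization accompanying the completion by the edge `e = (u, n, v)`:
the two contexts obtained by splitting a context of `G` at `n` both inherit the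
original value. (`n_−, n_+` are taken w.r.t. the graph `G` before insertion.) -/
noncomputable def CompParam (G : RegGraph V ρ) (K : Param V) (e : V × ℕ × V) : Param V :=
  fun w ω =>
    if w = e.2.2 ∧ (ω e.1 = (nminus G e.1 e.2.2 e.2.1, e.2.1) ∨
                    ω e.1 = (e.2.1, nplus G e.1 e.2.2 e.2.1))
    then K e.2.2 (Function.update ω e.1 (nminus G e.1 e.2.2 e.2.1, nplus G e.1 e.2.2 e.2.1))
    else K w ω

/-- One completion step: add the least missing edge (w.r.t. the fixed total
order) and extend the parametrization conservatively; complete graphs are fixed. -/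
noncomputable def Comp [LinearOrder (V × ℕ × V)] (P : RegGraph V ρ × Param V) :
    RegGraph V ρ × Param V :=
  if h : ((allEdges ρ) \ P.1.E).Nonempty then
    (⟨insert (((allEdges ρ) \ P.1.E).min' h) P.1.E, by
        intro e' he'
        rcases Finset.mem_insert.mp he' with h1 | h1
        · have hmem := Finset.min'_mem ((allEdges ρ) \ P.1.E) h
          have hall : ((allEdges ρ) \ P.1.E).min' h ∈ allEdges ρ :=
            (Finset.mem_sdiff.mp hmem).1
          rw [h1]
          exact (Finset.mem_filter.mp hall).2
        · exact P.1.valid e' h1⟩,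
      CompParam P.1 P.2 (((allEdges ρ) \ P.1.E).min' h))
  else P

/-- `P` is a fixed point of `f` reached by iterating `f` from `start`. -/
def IsFixReached {α : Type*} (f : α → α) (start P : α) : Prop :=
  (∃ n : ℕ, f^[n] start = P) ∧ f P = P

/-- Equality of parametrized regulatory graphs: the graphs coincide and the
parametrizations agree on all regulatory contexts. -/
def PGEq (A B : RegGraph V ρ × Param V) : Prop :=
  A.1 = B.1 ∧ ∀ v : V, ∀ ω ∈ Context A.1 v, A.2 v ω = B.2 v ω

/-- Replacing the value of `K` at component `v` and context `ω` by `j'`. -/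
noncomputable def replaceAt (K : Param V) (v : V) (ω : V → ℕ × ℕ) (j' : ℕ) : Param V :=
  fun w ω' => if w = v ∧ ω' = ω then j' else K w ω'

/-- The edge `e = (u,n,v)` is not observable in the parametrization `K`. -/
def NotObsParam (G : RegGraph V ρ) (K : Param V) (e : V × ℕ × V) : Prop :=
  ∀ ω ∈ Context G e.2.2, ω e.1 = (e.2.1, nplus G e.1 e.2.2 e.2.1) →
    K e.2.2 ω = K e.2.2 (Function.update ω e.1 (nminus G e.1 e.2.2 e.2.1, e.2.1))

/-- The edge `e = (u,n,v)` is not observable in the transition system `T_G(K)`. -/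
def NotObsTS (G : RegGraph V ρ) (K : Param V) (e : V × ℕ × V) : Prop :=
  ∀ s ∈ States ρ, nminus G e.1 e.2.2 e.2.1 ≤ s e.1 → s e.1 < nplus G e.1 e.2.2 e.2.1 →
    ∃ k ≤ ρ e.2.2, ∀ j : ℕ, nminus G e.1 e.2.2 e.2.1 ≤ j → j < nplus G e.1 e.2.2 e.2.1 →
      delta G K e.2.2 (Function.update s e.1 j) =
        Int.sign ((k : ℤ) - ((Function.update s e.1 j) e.2.2 : ℤ))

/-- The monotone target value `(F^K_v)^{mon}(s)`. -/
noncomputable def mon (G : RegGraph V ρ) (K : Param V) (v : V) (s : V → ℕ) : ℕ :=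
  if delta G K v s = 0 then s v
  else if delta G K v s = 1 then
    sInf {j | s v < j ∧ delta G K v (Function.update s v j) ≠ 1}
  else
    sSup {j | j < s v ∧ delta G K v (Function.update s v j) ≠ -1}

/-- Non-observability of `e = (u,n,v)` in `T_G(K)` phrased via monotone target values. -/
def NotObsTSmon (G : RegGraph V ρ) (K : Param V) (e : V × ℕ × V) : Prop :=
  ∀ s ∈ States ρ, nminus G e.1 e.2.2 e.2.1 ≤ s e.1 → s e.1 < nplus G e.1 e.2.2 e.2.1 →
    ∀ j : ℕ, nminus G e.1 e.2.2 e.2.1 ≤ j → j < nplus G e.1 e.2.2 e.2.1 →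
      delta G K e.2.2 (Function.update s e.1 j) =
        Int.sign ((mon G K e.2.2 s : ℤ) - ((Function.update s e.1 j) e.2.2 : ℤ))

/-- In the normalization algorithm: the context below the current one
(the `v`-interval is replaced by its predecessor interval `[n_{i−1}, n_i)`). -/
noncomputable def updLow (G : RegGraph V ρ) (v : V) (ω : V → ℕ × ℕ) : V → ℕ × ℕ :=
  Function.update ω v (sSup {m | m ∈ Theta G v v ∧ m < (ω v).1}, (ω v).1)

/-- In the normalization algorithm: the context above the current one
(the `v`-interval is replaced by its successor interval `[n_{i+1}, n_{i+2})`). -/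
noncomputable def updHigh (G : RegGraph V ρ) (v : V) (ω : V → ℕ × ℕ) : V → ℕ × ℕ :=
  Function.update ω v ((ω v).2, sInf {m | m ∈ Theta G v v ∧ (ω v).2 < m})

/-- The recursive normalization algorithm `Norm(K, v, ω)` of the paper, as an
inductive big-step relation: `NormRel G K v ω r` holds iff the recursion
started at `ω` terminates with result `r`. -/
inductive NormRel (G : RegGraph V ρ) (K : Param V) (v : V) : (V → ℕ × ℕ) → ℕ → Prop
  | inside (ω : V → ℕ × ℕ) (h1 : (ω v).1 ≤ K v ω) (h2 : K v ω < (ω v).2) :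
      NormRel G K v ω (K v ω)
  | belowStop (ω : V → ℕ × ℕ) (h : K v ω < (ω v).1)
      (h2 : (ω v).1 - 1 ≤ K v (updLow G v ω)) :
      NormRel G K v ω ((ω v).1 - 1)
  | belowRec (ω : V → ℕ × ℕ) (r : ℕ) (h : K v ω < (ω v).1)
      (h2 : K v (updLow G v ω) < (ω v).1 - 1)
      (hrec : NormRel G K v (updLow G v ω) r) :
      NormRel G K v ω r
  | aboveStop (ω : V → ℕ × ℕ) (h : (ω v).2 ≤ K v ω)
      (h2 : K v (updHigh G v ω) ≤ (ω v).2) :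
      NormRel G K v ω ((ω v).2)
  | aboveRec (ω : V → ℕ × ℕ) (r : ℕ) (h : (ω v).2 ≤ K v ω)
      (h2 : (ω v).2 < K v (updHigh G v ω))
      (hrec : NormRel G K v (updHigh G v ω) r) :
      NormRel G K v ω r

/-- The normalized parametrization: each context gets the common monotone
target value of its states (represented by the lower corner of the context). -/
noncomputable def NormPm (G : RegGraph V ρ) (K : Param V) : Param V :=
  fun v ω => mon G K v (fun u => (ω u).1)

/-- The edges of `G` that are not observable in `N`. -/
noncomputable def nonObsEdges (G : RegGraph V ρ) (N : Param V) : Finset (V × ℕ × V) :=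
  G.E.filter (fun e => NotObsParam G N e)

/-- The parametrization accompanying the removal of the non-observable edge
`e = (u,n,v)`: the two contexts merged into one pass on their common value. -/
noncomputable def MinParam (G : RegGraph V ρ) (N : Param V) (e : V × ℕ × V) : Param V :=
  fun w ω =>
    if w = e.2.2 ∧ ω e.1 = (nminus G e.1 e.2.2 e.2.1, nplus G e.1 e.2.2 e.2.1)
    then N e.2.2 (Function.update ω e.1 (nminus G e.1 e.2.2 e.2.1, e.2.1))
    else N w ω

/-- One minimization step: remove the least edge (w.r.t. the fixed total order)
that is not observable in `N`; if all edges are observable, do nothing. -/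
noncomputable def Minim [LinearOrder (V × ℕ × V)] (P : RegGraph V ρ × Param V) :
    RegGraph V ρ × Param V :=
  if h : (nonObsEdges P.1 P.2).Nonempty then
    (⟨P.1.E.erase ((nonObsEdges P.1 P.2).min' h),
        fun e' he' => P.1.valid e' (Finset.mem_of_mem_erase he')⟩,
      MinParam P.1 P.2 ((nonObsEdges P.1 P.2).min' h))
  else P


theorem ctx_mem (G : RegGraph V ρ) (v : V) (s : V → ℕ) (hs : s ∈ States ρ) :
    ctxOf G v s ∈ Context G v := by
  intro u
  have hsu : s u ≤ ρ u := hs u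
  have hb : BddAbove {m | m ∈ Theta G u v ∧ m ≤ s u} := ⟨s u, fun m hm => hm.2⟩
  have h1 := Nat.sSup_mem (s := {m | m ∈ Theta G u v ∧ m ≤ s u})
    ⟨0, by simp [Theta]⟩ hb
  have h2 := Nat.sInf_mem (s := {m | m ∈ Theta G u v ∧ s u < m})
    ⟨ρ u + 1, by simp [Theta]; omega⟩
  refine ⟨h1.1, h2.1, lt_of_le_of_lt h1.2 h2.2, ?_⟩
  rintro l hl ⟨ha, hb'⟩
  simp only [ctxOf] at ha hb'
  by_cases hc : l ≤ s u
  · exact absurd (le_csSup hb ⟨hl, hc⟩) (not_le.mpr ha)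
  · exact absurd (Nat.sInf_le (⟨hl, not_le.mp hc⟩ : l ∈ {m | m ∈ Theta G u v ∧ s u < m}))
      (not_le.mpr hb')

theorem delta_cases (G : RegGraph V ρ) (K : Param V) (v : V) (s : V → ℕ) :
    delta G K v s = 0 ∨ delta G K v s = 1 ∨ delta G K v s = -1 := by
  unfold delta F
  split_ifs <;> omega

theorem delta_top (G : RegGraph V ρ) (K : Param V) (hK : IsParam G K) (v : V) (s : V → ℕ)
    (hs : s ∈ States ρ) (h : s v = ρ v) : delta G K v s ≠ 1 := by
  have := hK v _ (ctx_mem G v s hs)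
  unfold delta F
  split_ifs <;> omega

theorem delta_bot (G : RegGraph V ρ) (K : Param V) (v : V) (s : V → ℕ)
    (h : s v = 0) : delta G K v s ≠ -1 := by
  unfold delta F
  split_ifs <;> omega

theorem mon_up (G : RegGraph V ρ) (K : Param V) (hK : IsParam G K) (v : V) (s : V → ℕ)
    (hs : s ∈ States ρ) (h : delta G K v s = 1) :
    s v < mon G K v s ∧ delta G K v (Function.update s v (mon G K v s)) ≠ 1 ∧
      mon G K v s ≤ ρ v ∧
      ∀ j, s v < j → j < mon G K v s → delta G K v (Function.update s v j) = 1 := by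
  have hm : mon G K v s = sInf {j | s v < j ∧ delta G K v (Function.update s v j) ≠ 1} := by
    simp [mon, h]
  have hsv : s v ≤ ρ v := hs v
  have hne : s v ≠ ρ v := fun hh => delta_top G K hK v s hs hh h
  have hmem : ρ v ∈ {j | s v < j ∧ delta G K v (Function.update s v j) ≠ 1} := by
    refine ⟨by omega, delta_top G K hK v _ ?_ (by simp)⟩
    intro w
    by_cases hw : w = v
    · subst hw; simp
    · simpa [hw] using hs w
  have h1 := Nat.sInf_mem ⟨_, hmem⟩
  have h2 := Nat.sInf_le hmem
  rw [← hm] at h1 h2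
  refine ⟨h1.1, h1.2, h2, ?_⟩
  intro j hj hjm
  by_contra hc
  have hjmem : j ∈ {j | s v < j ∧ delta G K v (Function.update s v j) ≠ 1} := ⟨hj, hc⟩
  have := Nat.sInf_le hjmem
  omega

theorem mon_down (G : RegGraph V ρ) (K : Param V) (v : V) (s : V → ℕ)
    (h : delta G K v s = -1) :
    mon G K v s < s v ∧ delta G K v (Function.update s v (mon G K v s)) ≠ -1 ∧
      ∀ j, mon G K v s < j → j < s v → delta G K v (Function.update s v j) = -1 := by
  have hm : mon G K v s = sSup {j | j < s v ∧ delta G K v (Function.update s v j) ≠ -1} := by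
    simp [mon, h]
  have hne : s v ≠ 0 := fun hh => delta_bot G K v s hh h
  have hmem : 0 ∈ {j | j < s v ∧ delta G K v (Function.update s v j) ≠ -1} :=
    ⟨by omega, delta_bot G K v _ (by simp)⟩
  have hb : BddAbove {j | j < s v ∧ delta G K v (Function.update s v j) ≠ -1} :=
    ⟨s v, fun m hm => le_of_lt hm.1⟩
  have h1 := Nat.sSup_mem ⟨_, hmem⟩ hb
  rw [← hm] at h1
  refine ⟨h1.1, h1.2, ?_⟩
  intro j hjm hj
  by_contra hc
  have := le_csSup hb
    (⟨hj, hc⟩ : j ∈ {j | j < s v ∧ delta G K v (Function.update s v j) ≠ -1})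
  omega

theorem mon_zero (G : RegGraph V ρ) (K : Param V) (v : V) (s : V → ℕ)
    (h : delta G K v s = 0) : mon G K v s = s v := by
  simp [mon, h]

theorem mon_le (G : RegGraph V ρ) (K : Param V) (hK : IsParam G K) (v : V) (s : V → ℕ)
    (hs : s ∈ States ρ) : mon G K v s ≤ ρ v := by
  have hsv : s v ≤ ρ v := hs v
  rcases delta_cases G K v s with h | h | h
  · rw [mon_zero G K v s h]; exact hsv
  · exact (mon_up G K hK v s hs h).2.2.1
  · have := (mon_down G K v s h).1
    omega

theorem sign_mon (G : RegGraph V ρ) (K : Param V) (hK : IsParam G K) (v : V) (s : V → ℕ)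
    (hs : s ∈ States ρ) : Int.sign ((mon G K v s : ℤ) - (s v : ℤ)) = delta G K v s := by
  rcases delta_cases G K v s with h | h | h
  · rw [mon_zero G K v s h, h]; simp
  · rw [h, Int.sign_eq_one_iff_pos]
    have := (mon_up G K hK v s hs h).1
    omega
  · rw [h, Int.sign_eq_neg_one_iff_neg]
    have := (mon_down G K v s h).1
    omega

/-- The two non-observability conditions in the transition
system — via an existential target value, and via the monotone target
value — are equivalent. -/
theorem notObsTS_iff_notObsTSmon {V : Type*} [DecidableEq V] [Fintype V]
    {ρ : V → ℕ} (hρ : ∀ v, 1 ≤ ρ v) (G : RegGraph V ρ)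
    (K : Param V) (hK : IsParam G K)
    (e : V × ℕ × V) (he : e ∈ G.E) :
    NotObsTS G K e ↔ NotObsTSmon G K e := by
  constructor
  · intro H s hs h1 h2 j hj1 hj2
    obtain ⟨k, -, hk⟩ := H s hs h1 h2
    obtain ⟨u, n, v⟩ := e
    simp only at *
    by_cases huv : u = v
    · subst huv
      simp only [Function.update_self] at hk ⊢
      have h0 := hk (s u) h1 h2
      rw [Function.update_eq_self] at h0
      rw [hk j hj1 hj2]
      rcases delta_cases G K u s with h | h | h
      · rw [mon_zero G K u s h]
        rw [h] at h0
        have := Int.sign_eq_zero_iff_zero.mp h0.symm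
        congr 1; omega
      · obtain ⟨a1, a2, -, a3⟩ := mon_up G K hK u s hs h
        rw [h] at h0
        have hpos := Int.sign_eq_one_iff_pos.mp h0.symm
        have b1 : mon G K u s < nplus G u u n → k ≤ mon G K u s := by
          intro hlt
          rw [hk _ (by omega) hlt] at a2
          by_contra hc
          exact a2 (Int.sign_eq_one_iff_pos.mpr (by omega))
        have b2 : k < nplus G u u n → mon G K u s ≤ k := by
          intro hlt
          by_contra hc
          have := a3 k (by omega) (by omega)
          rw [hk _ (by omega) hlt] at this
          simp at this
        by_cases hkn : k < nplus G u u n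
        · have : k = mon G K u s := by
            have := b2 hkn
            have := b1 (by omega)
            omega
          rw [this]
        · have : nplus G u u n ≤ mon G K u s := by
            by_contra hc
            have := b1 (by omega)
            omega
          rw [Int.sign_eq_one_iff_pos.mpr (by omega), Int.sign_eq_one_iff_pos.mpr (by omega)]
      · obtain ⟨a1, a2, a3⟩ := mon_down G K u s h
        rw [h] at h0
        have hpos := Int.sign_eq_neg_one_iff_neg.mp h0.symm
        have b1 : nminus G u u n ≤ mon G K u s → mon G K u s ≤ k := by
          intro hlt
          rw [hk _ hlt (by omega)] at a2
          by_contra hc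
          exact a2 (Int.sign_eq_neg_one_iff_neg.mpr (by omega))
        have b2 : nminus G u u n ≤ k → k ≤ mon G K u s := by
          intro hlt
          by_contra hc
          have := a3 k (by omega) (by omega)
          rw [hk _ hlt (by omega)] at this
          simp at this
        by_cases hkn : nminus G u u n ≤ k
        · have : k = mon G K u s := by
            have := b2 hkn
            have := b1 (by omega)
            omega
          rw [this]
        · have : mon G K u s < nminus G u u n := by
            by_contra hc
            have := b1 (by omega)
            omega
          rw [Int.sign_eq_neg_one_iff_neg.mpr (by omega),
            Int.sign_eq_neg_one_iff_neg.mpr (by omega)]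
    · have hvu : v ≠ u := fun h => huv h.symm
      simp only [Function.update_of_ne hvu] at hk ⊢
      have h0 := hk (s u) h1 h2
      rw [Function.update_eq_self] at h0
      rw [hk j hj1 hj2, sign_mon G K hK v s hs, h0]
  · intro H s hs h1 h2
    exact ⟨mon G K e.2.2 s, mon_le G K hK _ s hs, H s hs h1 h2⟩

end MVReg
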